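/- Under the stated classification setup, the probability of misclassifying the query pattern with the tangent distance method satisfies ℙ( l̃ ≠ m ) ≤ ((M−1)/ε) · T_m · √d · K_m · η_min(Gᵐ(λ_rᵐ))⁻¹ · ( (1/2)·√(tr(Gᵐ(λ_rᵐ)))·Δ² + √d · V_m · Δ ). -/

import Mathlib

open scoped RealInnerProductSpace BigOperators

/-- The `i`-th partial derivative `∂ᵢp(x) ∈ H` of a map `p : ℝᵈ → H`. -/
noncomputable def pderiv {H : Type*} [NormedAddCommGroup H] [NormedSpace ℝ H] {d : ℕ}
    (p : EuclideanSpace ℝ (Fin d) → H) (i : Fin d) (x : EuclideanSpace ℝ (Fin d)) : H :=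
  fderiv ℝ p x (EuclideanSpace.single i 1)

/-- The second partial derivative `∂ᵢⱼp(x) ∈ H`. -/
noncomputable def pderiv2 {H : Type*} [NormedAddCommGroup H] [NormedSpace ℝ H] {d : ℕ}
    (p : EuclideanSpace ℝ (Fin d) → H) (i j : Fin d) (x : EuclideanSpace ℝ (Fin d)) : H :=
  fderiv ℝ (fun y => pderiv p j y) x (EuclideanSpace.single i 1)

/-- The Gram (metric) matrix `G(x)ᵢⱼ = ⟨∂ᵢp(x), ∂ⱼp(x)⟩`. -/
noncomputable def gram {H : Type*} [NormedAddCommGroup H] [InnerProductSpace ℝ H] {d : ℕ}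
    (p : EuclideanSpace ℝ (Fin d) → H) (x : EuclideanSpace ℝ (Fin d)) :
    Matrix (Fin d) (Fin d) ℝ :=
  Matrix.of fun i j => ⟪pderiv p i x, pderiv p j x⟫

/-- Smallest eigenvalue of a symmetric real matrix. -/
noncomputable def etaMin {d : ℕ} (A : Matrix (Fin d) (Fin d) ℝ) : ℝ :=
  if h : A.IsHermitian then ⨅ i, h.eigenvalues i else 0


/-- The differential expressed through the partial derivatives. -/
theorem fderiv_eq_sum_pderiv {H : Type*} [NormedAddCommGroup H] [NormedSpace ℝ H] {d : ℕ}
    (f : EuclideanSpace ℝ (Fin d) → H) (x h : EuclideanSpace ℝ (Fin d)) :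
    fderiv ℝ f x h = ∑ i, h i • pderiv f i x := by
  have hsum : h = ∑ i, h i • EuclideanSpace.single i (1 : ℝ) := by
    simpa using ((EuclideanSpace.basisFun (Fin d) ℝ).sum_repr h).symm
  conv_lhs => rw [hsum]
  simp only [map_sum, map_smul, pderiv]

/-- A bound on the partial derivatives bounds the differential with respect to the `ℓ¹` norm. -/
theorem norm_fderiv_apply_le_of_norm_pderiv_le {H : Type*} [NormedAddCommGroup H]
    [NormedSpace ℝ H] {d : ℕ} {f : EuclideanSpace ℝ (Fin d) → H} {C : ℝ}
    {x : EuclideanSpace ℝ (Fin d)} (hC : ∀ i, ‖pderiv f i x‖ ≤ C)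
    (h : EuclideanSpace ℝ (Fin d)) :
    ‖fderiv ℝ f x h‖ ≤ C * ∑ i, |h i| := by
  rw [fderiv_eq_sum_pderiv, Finset.mul_sum]
  refine norm_sum_le_of_le _ fun i _ => ?_
  rw [norm_smul, Real.norm_eq_abs, mul_comm]
  exact mul_le_mul_of_nonneg_right (hC i) (abs_nonneg _)

/-- A bound on the partial derivatives is a Lipschitz constant for the `ℓ¹` norm. -/
theorem norm_sub_le_of_norm_pderiv_le {H : Type*} [NormedAddCommGroup H] [NormedSpace ℝ H]
    {d : ℕ} {f : EuclideanSpace ℝ (Fin d) → H} (hf : Differentiable ℝ f) {C : ℝ}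
    (hC : ∀ x i, ‖pderiv f i x‖ ≤ C) (x y : EuclideanSpace ℝ (Fin d)) :
    ‖f y - f x‖ ≤ C * ∑ i, |y i - x i| := by
  have hderiv : ∀ t ∈ Set.Icc (0 : ℝ) 1,
      HasDerivWithinAt (fun t : ℝ => f (x + t • (y - x))) (fderiv ℝ f (x + t • (y - x)) (y - x))
        (Set.Icc 0 1) t := fun t _ => by
    have hline : HasDerivAt (fun t : ℝ => x + t • (y - x)) (y - x) t := by
      simpa using ((hasDerivAt_id t).smul_const (y - x)).const_add x
    exact ((hf _).hasFDerivAt.comp_hasDerivAt t hline).hasDerivWithinAt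
  have := norm_image_sub_le_of_norm_deriv_le_segment_01' hderiv fun t _ =>
    norm_fderiv_apply_le_of_norm_pderiv_le (hC (x + t • (y - x))) (y - x)
  simpa using this

theorem differentiable_pderiv {H : Type*} [NormedAddCommGroup H] [NormedSpace ℝ H] {d : ℕ}
    {p : EuclideanSpace ℝ (Fin d) → H} (hp : ContDiff ℝ 2 p) (i : Fin d) :
    Differentiable ℝ (pderiv p i) := by
  have h : ContDiff ℝ 1 (fderiv ℝ p) := hp.fderiv_right (by norm_num)
  exact (h.differentiable (by norm_num)).clm_apply (differentiable_const _)

/-- Second order Taylor remainder estimate with respect to the `ℓ¹` norm. -/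
theorem norm_sub_sub_fderiv_le_of_norm_pderiv2_le {H : Type*} [NormedAddCommGroup H]
    [NormedSpace ℝ H] {d : ℕ} {p : EuclideanSpace ℝ (Fin d) → H} (hp : ContDiff ℝ 2 p) {K : ℝ}
    (hK : ∀ x i k, ‖pderiv2 p i k x‖ ≤ K) (x y : EuclideanSpace ℝ (Fin d)) :
    ‖p y - p x - fderiv ℝ p x (y - x)‖ ≤ 1 / 2 * K * (∑ i, |y i - x i|) ^ 2 := by
  set s := ∑ i, |y i - x i| with hs
  have hdiff : Differentiable ℝ p := hp.differentiable (by norm_num)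
  have hderiv : ∀ t : ℝ, HasDerivAt
      (fun t : ℝ => p (x + t • (y - x)) - p x - t • fderiv ℝ p x (y - x))
      (fderiv ℝ p (x + t • (y - x)) (y - x) - fderiv ℝ p x (y - x)) t := fun t => by
    have hline : HasDerivAt (fun t : ℝ => x + t • (y - x)) (y - x) t := by
      simpa using ((hasDerivAt_id t).smul_const (y - x)).const_add x
    have h := ((hdiff _).hasFDerivAt.comp_hasDerivAt t hline).sub_const (p x)
    have h2 := h.sub ((hasDerivAt_id t).smul_const (fderiv ℝ p x (y - x)))
    rw [one_smul] at h2
    exact h2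
  have hbound : ∀ t ∈ Set.Ico (0 : ℝ) 1,
      ‖fderiv ℝ p (x + t • (y - x)) (y - x) - fderiv ℝ p x (y - x)‖ ≤ K * s ^ 2 * t := by
    intro t ht
    have hpart : ∀ i, ‖pderiv p i (x + t • (y - x)) - pderiv p i x‖ ≤ K * (t * s) := fun i => by
      have h := norm_sub_le_of_norm_pderiv_le (differentiable_pderiv hp i)
        (fun z k => hK z k i) x (x + t • (y - x))
      simpa [abs_mul, abs_of_nonneg ht.1, ← Finset.mul_sum, ← hs] using h
    rw [fderiv_eq_sum_pderiv, fderiv_eq_sum_pderiv, ← Finset.sum_sub_distrib]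
    calc _ ≤ ∑ i, |y i - x i| * (K * (t * s)) := by
          refine norm_sum_le_of_le _ fun i _ => ?_
          rw [← smul_sub, norm_smul, Real.norm_eq_abs, PiLp.sub_apply]
          exact mul_le_mul_of_nonneg_left (hpart i) (abs_nonneg _)
      _ = K * s ^ 2 * t := by rw [← Finset.sum_mul, ← hs]; ring
  have hB : ∀ t : ℝ, HasDerivAt (fun t : ℝ => 1 / 2 * K * s ^ 2 * t ^ 2) (K * s ^ 2 * t) t :=
    fun t => ((hasDerivAt_pow 2 t).const_mul (1 / 2 * K * s ^ 2)).congr_deriv (by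
      push_cast
      ring)
  have := image_norm_le_of_norm_deriv_right_le_deriv_boundary
    (fun t _ => (hderiv t).continuousAt.continuousWithinAt)
    (fun t _ => (hderiv t).hasDerivWithinAt) (by simp) hB hbound
    (Set.right_mem_Icc.2 zero_le_one)
  simpa using this

/-- The smallest eigenvalue bounds a symmetric positive definite matrix from below. -/
theorem etaMin_mul_norm_le {d : ℕ} {A : Matrix (Fin d) (Fin d) ℝ} (hA : A.PosDef)
    (u : EuclideanSpace ℝ (Fin d)) :
    etaMin A * ‖u‖ ≤ ‖WithLp.toLp 2 (A.mulVec u.ofLp)‖ := by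
  have hH := hA.isHermitian
  have heta : etaMin A = ⨅ i, hH.eigenvalues i := by rw [etaMin, dif_pos hH]
  have hη : 0 ≤ etaMin A := heta ▸ Real.iInf_nonneg fun i => (hA.eigenvalues_pos i).le
  have hle : ∀ i, etaMin A ≤ hH.eigenvalues i := fun i =>
    heta ▸ ciInf_le (Set.finite_range _).bddBelow i
  have hinner : ∀ i, ⟪hH.eigenvectorBasis i, WithLp.toLp 2 (A.mulVec u.ofLp)⟫ =
      hH.eigenvalues i * ⟪hH.eigenvectorBasis i, u⟫ := fun i => by
    have hsymm := (Matrix.isSymmetric_toEuclideanLin_iff.2 hH) (hH.eigenvectorBasis i) u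
    have hev : A.toEuclideanLin (hH.eigenvectorBasis i) =
        hH.eigenvalues i • hH.eigenvectorBasis i := by
      ext k
      simpa using congrFun (hH.mulVec_eigenvectorBasis i) k
    rw [hev, real_inner_smul_left] at hsymm
    exact hsymm.symm
  refine le_of_sq_le_sq ?_ (norm_nonneg _)
  rw [mul_pow, ← hH.eigenvectorBasis.sum_sq_norm_inner_right u,
    ← hH.eigenvectorBasis.sum_sq_norm_inner_right (WithLp.toLp 2 (A.mulVec u.ofLp)),
    Finset.mul_sum]
  refine Finset.sum_le_sum fun i _ => ?_
  rw [hinner, norm_mul, mul_pow]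
  gcongr
  exact (hle i).trans (Real.le_norm_self _)

theorem etaMin_pos {d : ℕ} (hd : 0 < d) {A : Matrix (Fin d) (Fin d) ℝ} (hA : A.PosDef) :
    0 < etaMin A := by
  have : Nonempty (Fin d) := ⟨⟨0, hd⟩⟩
  obtain ⟨i, hi⟩ := exists_eq_ciInf_of_finite (f := hA.isHermitian.eigenvalues)
  rw [etaMin, dif_pos hA.isHermitian, ← hi]
  exact hA.eigenvalues_pos i

/-- Error of the tangent distance estimate `e`, computed from the reference parameter `r`, of the
parameter `o` of a critical point of the distance from `v` to the image of `p`. -/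
theorem norm_tangentDistanceEstimate_sub_le {H : Type*} [NormedAddCommGroup H]
    [InnerProductSpace ℝ H] {d : ℕ} (hd : 0 < d) {p : EuclideanSpace ℝ (Fin d) → H}
    (hp : ContDiff ℝ 2 p) {K : ℝ} (hK : ∀ x i k, ‖pderiv2 p i k x‖ ≤ K)
    {r o e : EuclideanSpace ℝ (Fin d)} (hPD : (gram p r).PosDef) {v : H}
    (horth : ∀ i, ⟪v - p o, pderiv p i o⟫ = 0)
    (he : ∀ i, e i = r i + ∑ k, (gram p r)⁻¹ i k * ⟪v - p r, pderiv p k r⟫) :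
    ‖e - o‖ ≤ K * (etaMin (gram p r))⁻¹ *
      (1 / 2 * √(gram p r).trace * (∑ i, |o i - r i|) ^ 2 +
        √d * ‖v - p o‖ * ∑ i, |o i - r i|) := by
  set s := ∑ i, |o i - r i| with hs
  have hK0 : 0 ≤ K := (norm_nonneg _).trans (hK 0 ⟨0, hd⟩ ⟨0, hd⟩)
  have hs0 : 0 ≤ s := Finset.sum_nonneg fun i _ => abs_nonneg _
  let a : EuclideanSpace ℝ (Fin d) := WithLp.toLp 2 fun k => ⟪v - p o, pderiv p k r⟫
  let b : EuclideanSpace ℝ (Fin d) :=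
    WithLp.toLp 2 fun k => ⟪p o - p r - fderiv ℝ p r (o - r), pderiv p k r⟫
  have hlin : WithLp.toLp 2 ((gram p r).mulVec (e - o).ofLp) = a + b := by
    have hsub : (e - o).ofLp = (r - o).ofLp +
        (gram p r)⁻¹.mulVec (fun k => ⟪v - p r, pderiv p k r⟫) := by
      ext i
      simp only [PiLp.sub_apply, Pi.add_apply, he, Matrix.mulVec, dotProduct]
      ring
    rw [hsub, Matrix.mulVec_add, Matrix.mulVec_mulVec,
      Matrix.mul_nonsing_inv _ hPD.det_pos.ne'.isUnit, Matrix.one_mulVec]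
    ext k
    have hG : (gram p r).mulVec (r - o).ofLp k = -⟪fderiv ℝ p r (o - r), pderiv p k r⟫ := by
      rw [fderiv_eq_sum_pderiv, sum_inner, ← Finset.sum_neg_distrib]
      simp only [Matrix.mulVec, dotProduct, gram, Matrix.of_apply]
      refine Finset.sum_congr rfl fun i _ => ?_
      rw [real_inner_smul_left, real_inner_comm, PiLp.sub_apply, PiLp.sub_apply]
      ring
    simp only [PiLp.add_apply, Pi.add_apply, hG, a, b, inner_sub_left]
    ring
  have ha : ‖a‖ ≤ √d * (‖v - p o‖ * (K * s)) := by
    have hak : ∀ k, ‖a k‖ ≤ ‖v - p o‖ * (K * s) := fun k => by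
      have h1 : a k = -⟪v - p o, pderiv p k o - pderiv p k r⟫ := by
        simp [a, inner_sub_right _ (pderiv p k o), horth]
      rw [h1, norm_neg]
      refine (norm_inner_le_norm _ _).trans (mul_le_mul_of_nonneg_left ?_ (norm_nonneg _))
      exact norm_sub_le_of_norm_pderiv_le (differentiable_pderiv hp k) (fun z i => hK z i k) r o
    rw [EuclideanSpace.norm_eq]
    refine Real.sqrt_le_iff.2 ⟨by positivity, ?_⟩
    rw [mul_pow, Real.sq_sqrt d.cast_nonneg]
    calc _ ≤ ∑ _k : Fin d, (‖v - p o‖ * (K * s)) ^ 2 := by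
          gcongr with k
          exact hak k
      _ = _ := by simp
  have hb : ‖b‖ ≤ 1 / 2 * K * s ^ 2 * √(gram p r).trace := by
    have hbk : ∀ k, ‖b k‖ ≤ 1 / 2 * K * s ^ 2 * ‖pderiv p k r‖ := fun k =>
      (norm_inner_le_norm _ _).trans (mul_le_mul_of_nonneg_right
        (norm_sub_sub_fderiv_le_of_norm_pderiv2_le hp hK r o) (norm_nonneg _))
    have htr : (gram p r).trace = ∑ k, ‖pderiv p k r‖ ^ 2 := by
      simp [Matrix.trace, gram]
    rw [EuclideanSpace.norm_eq]
    refine Real.sqrt_le_iff.2 ⟨by positivity, ?_⟩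
    rw [htr, mul_pow, Real.sq_sqrt (by positivity), Finset.mul_sum]
    refine Finset.sum_le_sum fun k _ => ?_
    rw [← mul_pow]
    exact pow_le_pow_left₀ (norm_nonneg _) (hbk k) 2
  have hη := etaMin_pos hd hPD
  have hmain := (etaMin_mul_norm_le hPD (e - o)).trans (hlin ▸ norm_add_le a b)
  calc ‖e - o‖ = (etaMin (gram p r))⁻¹ * (etaMin (gram p r) * ‖e - o‖) := by field_simp
    _ ≤ (etaMin (gram p r))⁻¹ *
        (√d * (‖v - p o‖ * (K * s)) + 1 / 2 * K * s ^ 2 * √(gram p r).trace) := by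
      gcongr
      linarith
    _ = _ := by ring

/-- The `ℓ¹` norm is at most `√d` times the Euclidean norm. -/
theorem sum_abs_le_sqrt_mul_norm {d : ℕ} (u : EuclideanSpace ℝ (Fin d)) :
    ∑ i, |u i| ≤ √d * ‖u‖ := by
  rw [EuclideanSpace.norm_eq, ← Real.sqrt_mul d.cast_nonneg]
  refine Real.le_sqrt_of_sq_le ?_
  simpa using sq_sum_le_card_mul_sum_sq (s := Finset.univ) (f := fun i => |u i|)

open MeasureTheory in
/-- Misclassification probability bound for the tangent distance method. -/
theorem tangent_distance_misclassification_probability_bound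
    {H : Type*} [NormedAddCommGroup H] [InnerProductSpace ℝ H]
    {Ω : Type*} [MeasurableSpace Ω] (μ : Measure Ω) [IsProbabilityMeasure μ]
    {d M : ℕ} (hd : 0 < d) (hM : 0 < M)
    (p : Fin M → EuclideanSpace ℝ (Fin d) → H) (hp : ∀ j, ContDiff ℝ 2 (p j))
    (m : Fin M)
    (q : Ω → H)
    (Km Tm : ℝ) (hKm : 0 ≤ Km) (hTm : 0 ≤ Tm)
    (hKb : ∀ (x : EuclideanSpace ℝ (Fin d)) (i k : Fin d), ‖pderiv2 (p m) i k x‖ ≤ Km)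
    (hTb : ∀ (x : EuclideanSpace ℝ (Fin d)) (i : Fin d), ‖pderiv (p m) i x‖ ≤ Tm)
    (lr : Fin M → EuclideanSpace ℝ (Fin d))
    (hPD : ∀ j, (gram (p j) (lr j)).PosDef)
    (lo : Fin M → Ω → EuclideanSpace ℝ (Fin d))
    (hlo : ∀ j ω (x : EuclideanSpace ℝ (Fin d)), ‖q ω - p j (lo j ω)‖ ≤ ‖q ω - p j x‖)
    (ν : Fin M → Ω → ℝ) (hν : ∀ j ω, ν j ω = ‖q ω - p j (lo j ω)‖)
    (horth : ∀ ω i, ⟪q ω - p m (lo m ω), pderiv (p m) i (lo m ω)⟫ = 0)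
    (Δ Vm ε : ℝ) (hε : 0 < ε)
    (hΔ : ∀ᵐ ω ∂μ, ∑ i, |lo m ω i - lr m i| ≤ Δ)
    (hVm : ∀ᵐ ω ∂μ, ν m ω ≤ Vm)
    (hsep : ∀ᵐ ω ∂μ, ∀ j, j ≠ m → ν m ω + ε ≤ ν j ω)
    (lE : Fin M → Ω → EuclideanSpace ℝ (Fin d))
    (hlE : ∀ j ω (i : Fin d), lE j ω i
        = lr j i + ∑ k, (gram (p j) (lr j))⁻¹ i k * ⟪q ω - p j (lr j), pderiv (p j) k (lr j)⟫)
    (lab : Ω → Fin M)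
    (hlab : ∀ ω j, ‖q ω - p (lab ω) (lE (lab ω) ω)‖ ≤ ‖q ω - p j (lE j ω)‖)
    (hmeas : MeasurableSet {ω | lab ω ≠ m})
    (hmeasν : ∀ j, Measurable (ν j))
    (hmeaserr : ∀ j, Measurable fun ω => ‖q ω - p j (lE j ω)‖) :
    (μ {ω | lab ω ≠ m}).toReal ≤
      ((M : ℝ) - 1) / ε * Tm * Real.sqrt (d : ℝ) * Km * (etaMin (gram (p m) (lr m)))⁻¹ *
        (1 / 2 * Real.sqrt (gram (p m) (lr m)).trace * Δ ^ 2 + Real.sqrt (d : ℝ) * Vm * Δ) := by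
  set η := etaMin (gram (p m) (lr m))
  set τ := √(gram (p m) (lr m)).trace
  have hη : 0 < η := etaMin_pos hd (hPD m)
  obtain ⟨ω₀, hΔ₀, hV₀⟩ := (hΔ.and hVm).exists
  have hΔ0 : 0 ≤ Δ := (Finset.sum_nonneg fun i _ => abs_nonneg _).trans hΔ₀
  have hV0 : 0 ≤ Vm := by
    rw [hν] at hV₀
    exact (norm_nonneg _).trans hV₀
  have hM1 : (0 : ℝ) ≤ (M : ℝ) - 1 := by
    have : (1 : ℝ) ≤ M := by exact_mod_cast hM
    linarith
  by_cases hnull : μ {ω | lab ω ≠ m} = 0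
  · rw [hnull, ENNReal.toReal_zero]
    positivity
  have hfreq : ∃ᵐ ω ∂μ, lab ω ≠ m := frequently_ae_iff.2 hnull
  obtain ⟨ω, hω, hΔω, hVω, hsepω⟩ := (hfreq.and_eventually (hΔ.and (hVm.and hsep))).exists
  have hM2 : (1 : ℝ) ≤ (M : ℝ) - 1 := by
    have : (2 : ℝ) ≤ M := by
      have hne : (lab ω : ℕ) ≠ m := fun h => hω (Fin.ext h)
      have := (lab ω).isLt
      have := m.isLt
      exact_mod_cast (by omega : 2 ≤ M)
    linarith
  have herr : ε ≤ ‖p m (lE m ω) - p m (lo m ω)‖ := by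
    have h1 := hsepω _ hω
    rw [hν, hν] at h1
    have h2 := hlo (lab ω) ω (lE (lab ω) ω)
    have h3 := hlab ω m
    have h4 := norm_sub_le (q ω - p m (lo m ω)) (p m (lE m ω) - p m (lo m ω))
    rw [sub_sub_sub_cancel_right] at h4
    linarith
  rw [hν] at hVω
  have hest := norm_tangentDistanceEstimate_sub_le hd (hp m) hKb (hPD m) (horth ω) (hlE m ω)
  have hε_le : ε ≤ Tm * (√d * (Km * η⁻¹ * (1 / 2 * τ * Δ ^ 2 + √d * Vm * Δ))) :=
    calc ε ≤ Tm * ∑ i, |(lE m ω - lo m ω) i| := by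
          simpa using herr.trans (norm_sub_le_of_norm_pderiv_le
            ((hp m).differentiable (by norm_num)) hTb (lo m ω) (lE m ω))
      _ ≤ Tm * (√d * ‖lE m ω - lo m ω‖) := by
          gcongr
          exact sum_abs_le_sqrt_mul_norm _
      _ ≤ _ := by
          gcongr
          refine hest.trans ?_
          gcongr
  calc (μ {ω | lab ω ≠ m}).toReal ≤ 1 := measureReal_le_one
    _ ≤ ((M : ℝ) - 1) / ε *
        (Tm * (√d * (Km * η⁻¹ * (1 / 2 * τ * Δ ^ 2 + √d * Vm * Δ)))) := by
      rw [div_mul_eq_mul_div, one_le_div hε]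
      nlinarith
    _ = _ := by ring
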